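/- arXiv:cs/9809003 — 12 statements merged into one kernel-verified Lean document; each statement's English description precedes it below -/
import Mathlib

section
/- For every event e and every set G of agents, the assignment 𝓔(i) = K_i(C_G e) for i ∈ G is an ensemble for G (i.e., each event K_i(C_G e) is local to agent i) and this ensemble is perfectly coordinated (i.e., if (r,m) ∈ K_i(C_G e) for some i ∈ G, then (r,m) ∈ K_j(C_G e) for all j ∈ G). -/
open Set

/-- Agent `i`'s knowledge operator: `(r,m) ∈ Kn st i e` iff `e` holds at all points
whose local state for `i` agrees with that of `(r,m)`. -/
def Kn {A Se : Type*} {S : A → Type*} {R : Type*}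
    (st : R → ℕ → Se × (∀ i, S i)) (i : A) (e : Set (R × ℕ)) : Set (R × ℕ) :=
  {p | ∀ q : R × ℕ, (st q.1 q.2).2 i = (st p.1 p.2).2 i → q ∈ e}

/-- Everyone in `G` knows `e`. -/
def En {A Se : Type*} {S : A → Type*} {R : Type*}
    (st : R → ℕ → Se × (∀ i, S i)) (G : Set A) (e : Set (R × ℕ)) : Set (R × ℕ) :=
  ⋂ i ∈ G, Kn st i e

/-- Common knowledge among `G` of `e`: the intersection of all iterates `(E_G)^k e`, `k ≥ 1`. -/
def Cn {A Se : Type*} {S : A → Type*} {R : Type*}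
    (st : R → ℕ → Se × (∀ i, S i)) (G : Set A) (e : Set (R × ℕ)) : Set (R × ℕ) :=
  ⋂ k ≥ 1, (En st G)^[k] e

/-- An event `e` is local to agent `i` if membership depends only on `i`'s local state. -/
def IsLocal {A Se : Type*} {S : A → Type*} {R : Type*}
    (st : R → ℕ → Se × (∀ i, S i)) (i : A) (e : Set (R × ℕ)) : Prop :=
  ∀ p q : R × ℕ, (st p.1 p.2).2 i = (st q.1 q.2).2 i → (p ∈ e ↔ q ∈ e)

theorem Kn_isLocal {A Se : Type*} {S : A → Type*} {R : Type*}
    (st : R → ℕ → Se × (∀ i, S i)) (i : A) (e : Set (R × ℕ)) : IsLocal st i (Kn st i e) := by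
  intro p q h
  simp only [Kn, mem_ofPred_eq, h]

theorem Kn_subset {A Se : Type*} {S : A → Type*} {R : Type*}
    (st : R → ℕ → Se × (∀ i, S i)) (i : A) (e : Set (R × ℕ)) : Kn st i e ⊆ e :=
  fun p hp => hp p rfl

theorem Cn_subset_Kn_Cn {A Se : Type*} {S : A → Type*} {R : Type*}
    (st : R → ℕ → Se × (∀ i, S i)) {G : Set A} {i : A} (hi : i ∈ G) (e : Set (R × ℕ)) :
    Cn st G e ⊆ Kn st i (Cn st G e) := by
  intro p hp q hq
  simp only [Cn, mem_iInter] at hp ⊢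
  intro k hk
  have h := hp (k + 1) (by lia)
  rw [Function.iterate_succ_apply'] at h
  simp only [En, mem_iInter] at h
  exact h i hi q hq

/-- Proposition 2(a): for every event `e` and set `G` of agents, the
assignment `𝓔(i) = K_i (C_G e)` is an ensemble for `G` (each `K_i (C_G e)` is local to `i`),
and this ensemble is perfectly coordinated. -/
theorem ensemble_KiCG_perfectly_coordinated
    {A Se : Type*} {S : A → Type*} {R : Type*}
    (st : R → ℕ → Se × (∀ i, S i)) (e : Set (R × ℕ)) (G : Set A) :
    (∀ i ∈ G, IsLocal st i (Kn st i (Cn st G e))) ∧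
    (∀ p : R × ℕ, ∀ i ∈ G, p ∈ Kn st i (Cn st G e) →
      ∀ j ∈ G, p ∈ Kn st j (Cn st G e)) := by
  exact ⟨fun i _ => Kn_isLocal st i _, fun _ i _ hp _ hj =>
    Cn_subset_Kn_Cn st hj e (Kn_subset st i _ hp)⟩
end

section
/- If 𝓔 is a perfectly coordinated ensemble for a set G of agents, then ψ_𝓔 ⊆ C_G ψ_𝓔, where ψ_𝓔 = ⋃_{i∈G} 𝓔(i); that is, at every point where some event of the ensemble holds, it is common knowledge among G that ψ_𝓔 holds. -/
open Set

theorem En_mono {A Se : Type*} {S : A → Type*} {R : Type*}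
    (st : R → ℕ → Se × (∀ i, S i)) (G : Set A) : Monotone (En st G) :=
  fun _ _ h => iInter₂_mono fun _ _ _ hp q hq => h (hp q hq)

/-- An event `e` contained in `E_G e` is contained in every iterate `(E_G)^k e`. -/
theorem subset_iterate_En {A Se : Type*} {S : A → Type*} {R : Type*}
    (st : R → ℕ → Se × (∀ i, S i)) (G : Set A) {e : Set (R × ℕ)}
    (h : e ⊆ En st G e) (k : ℕ) : e ⊆ (En st G)^[k] e := by
  induction k with
  | zero => exact Subset.rfl
  | succ k ih =>
    rw [Function.iterate_succ_apply']
    exact h.trans (En_mono st G ih)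

/-- Proposition 2(b): if `𝓔` is a perfectly coordinated ensemble for `G`,
then `ψ_𝓔 ⊆ C_G ψ_𝓔` where `ψ_𝓔 = ⋃_{i∈G} 𝓔(i)`. -/
theorem perfectly_coordinated_ensemble_common_knowledge
    {A Se : Type*} {S : A → Type*} {R : Type*}
    (st : R → ℕ → Se × (∀ i, S i)) (G : Set A) (𝓔 : A → Set (R × ℕ))
    (hloc : ∀ i ∈ G, IsLocal st i (𝓔 i))
    (hpc : ∀ p : R × ℕ, ∀ i ∈ G, p ∈ 𝓔 i → ∀ j ∈ G, p ∈ 𝓔 j) :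
    (⋃ i ∈ G, 𝓔 i) ⊆ Cn st G (⋃ i ∈ G, 𝓔 i) := by
  have hfix : (⋃ i ∈ G, 𝓔 i) ⊆ En st G (⋃ i ∈ G, 𝓔 i) := by
    intro p hp
    obtain ⟨i, hi, hpi⟩ := mem_iUnion₂.1 hp
    refine mem_iInter₂.2 fun j hj q hq => mem_iUnion₂.2 ⟨j, hj, ?_⟩
    exact (hloc j hj q p hq).2 (hpc p i hi hpi j hj)
  exact subset_iInter₂ fun k _ => subset_iterate_En st G hfix k
end

section
/- For every event e and every nonempty set G of agents, common knowledge C_G e is the greatest fixed point of the monotone map x ↦ E_G(e ∩ x) on events; that is, C_G e = E_G(e ∩ C_G e), and every event x satisfying x ⊆ E_G(e ∩ x) satisfies x ⊆ C_G e. Equivalently, C_G e = ⋃ {x : x ⊆ E_G(e ∩ x)}. -/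
open Set

theorem En_subset {A Se : Type*} {S : A → Type*} {R : Type*}
    (st : R → ℕ → Se × (∀ i, S i)) {G : Set A} (hG : G.Nonempty) (e : Set (R × ℕ)) :
    En st G e ⊆ e := by
  obtain ⟨i, hi⟩ := hG
  exact fun p hp => mem_iInter₂.1 hp i hi p rfl

theorem Cn_subset_En {A Se : Type*} {S : A → Type*} {R : Type*}
    (st : R → ℕ → Se × (∀ i, S i)) (G : Set A) (e : Set (R × ℕ)) :
    Cn st G e ⊆ En st G (e ∩ Cn st G e) := by
  intro p hp
  have key : ∀ k, p ∈ En st G ((En st G)^[k] e) := fun k => by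
    rw [← Function.iterate_succ_apply' (En st G) k e]
    exact mem_iInter₂.1 hp (k + 1) (Nat.le_add_left 1 k)
  exact mem_iInter₂.2 fun i hi q hq =>
    ⟨mem_iInter₂.1 (key 0) i hi q hq,
      mem_iInter₂.2 fun k _ => mem_iInter₂.1 (key k) i hi q hq⟩

theorem subset_Cn {A Se : Type*} {S : A → Type*} {R : Type*}
    (st : R → ℕ → Se × (∀ i, S i)) {G : Set A} (hG : G.Nonempty) {e x : Set (R × ℕ)}
    (hx : x ⊆ En st G (e ∩ x)) : x ⊆ Cn st G e := by
  have hxe : x ⊆ e := (hx.trans (En_subset st hG _)).trans inter_subset_left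
  have key : ∀ k, x ⊆ (En st G)^[k] e := fun k => by
    induction k with
    | zero => exact hxe
    | succ k ih =>
      rw [Function.iterate_succ_apply']
      exact hx.trans (En_mono st G (inter_subset_right.trans ih))
  exact subset_iInter₂ fun k _ => key k

/-- for every event `e` and nonempty set `G` of agents, `C_G e` is the
greatest fixed point of the monotone map `x ↦ E_G (e ∩ x)`: it is a fixed point, every
post-fixed point is below it, and it equals the union of all post-fixed points. -/
theorem Cn_greatest_fixed_point
    {A Se : Type*} {S : A → Type*} {R : Type*}
    (st : R → ℕ → Se × (∀ i, S i)) (e : Set (R × ℕ)) (G : Set A)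
    (hG : G.Nonempty) :
    Cn st G e = En st G (e ∩ Cn st G e) ∧
    (∀ x : Set (R × ℕ), x ⊆ En st G (e ∩ x) → x ⊆ Cn st G e) ∧
    Cn st G e = ⋃₀ {x : Set (R × ℕ) | x ⊆ En st G (e ∩ x)} := by
  refine ⟨?_, fun x hx => subset_Cn st hG hx, ?_⟩
  · exact (Cn_subset_En st G e).antisymm ((En_subset st hG _).trans inter_subset_right)
  · exact (subset_sUnion_of_mem (Cn_subset_En st G e)).antisymm
      (sUnion_subset fun x hx => subset_Cn st hG hx)
end

section
/- Let R be a system with temporal imprecision and let G be a set of agents with at least two elements. Then every perfectly coordinated ensemble 𝓔 for G is trivial: for every run r ∈ R, either (r,m) ∈ ⋃_{i∈G} 𝓔(i) for all times m, or (r,m) ∉ ⋃_{i∈G} 𝓔(i) for all times m. In particular, there are no nontrivial perfectly coordinated ensembles for G. -/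
open Set

/-- A system has temporal imprecision if for every run `r`, time `m`, and set `G` of at
least two agents, there are distinct `i, j ∈ G`, a run `r'`, and a time `m'` such that
`r'_i(m') = r_i(m)` while `r'_j(m') = r_j(m+1)`. -/
def TemporalImprecision {A Se : Type*} {S : A → Type*} {R : Type*}
    (st : R → ℕ → Se × (∀ i, S i)) : Prop :=
  ∀ (r : R) (m : ℕ) (G : Set A), G.Nontrivial →
    ∃ i ∈ G, ∃ j ∈ G, i ≠ j ∧ ∃ (r' : R) (m' : ℕ),
      (st r' m').2 i = (st r m).2 i ∧ (st r' m').2 j = (st r (m + 1)).2 j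

/-- Proposition 3: in a system with temporal imprecision, every perfectly
coordinated ensemble for a set `G` of at least two agents is trivial (in each run, the union
of the ensemble's events holds at all times or at no time); in particular, there are no
nontrivial perfectly coordinated ensembles for `G`. -/
theorem no_nontrivial_perfectly_coordinated_ensembles
    {A Se : Type*} {S : A → Type*} {R : Type*}
    (st : R → ℕ → Se × (∀ i, S i))
    (hti : TemporalImprecision st)
    (G : Set A) (hG : G.Nontrivial)
    (𝓔 : A → Set (R × ℕ))
    (hloc : ∀ i ∈ G, IsLocal st i (𝓔 i))
    (hpc : ∀ p : R × ℕ, ∀ i ∈ G, p ∈ 𝓔 i → ∀ j ∈ G, p ∈ 𝓔 j) :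
    (∀ r : R, (∀ m : ℕ, (r, m) ∈ ⋃ i ∈ G, 𝓔 i) ∨ (∀ m : ℕ, (r, m) ∉ ⋃ i ∈ G, 𝓔 i)) ∧
    ¬ ∃ (r : R) (m m' : ℕ), (r, m) ∈ ⋃ i ∈ G, 𝓔 i ∧ (r, m') ∉ ⋃ i ∈ G, 𝓔 i := by
  have hmem : ∀ p : R × ℕ, ∀ i ∈ G, p ∈ ⋃ i ∈ G, 𝓔 i ↔ p ∈ 𝓔 i := by
    intro p i hi
    simp only [mem_iUnion, exists_prop]
    exact ⟨fun ⟨j, hj, hp⟩ => hpc p j hj hp i hi, fun hp => ⟨i, hi, hp⟩⟩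
  have hstep : ∀ (r : R) (m : ℕ), (r, m) ∈ ⋃ i ∈ G, 𝓔 i ↔ (r, m + 1) ∈ ⋃ i ∈ G, 𝓔 i := by
    intro r m
    obtain ⟨i, hi, j, hj, -, r', m', hri, hrj⟩ := hti r m G hG
    rw [hmem (r, m) i hi, ← hloc i hi (r', m') (r, m) hri, ← hmem (r', m') i hi,
      hmem (r', m') j hj, hloc j hj (r', m') (r, m + 1) hrj, hmem (r, m + 1) j hj]
  have hzero : ∀ (r : R) (m : ℕ), (r, m) ∈ ⋃ i ∈ G, 𝓔 i ↔ (r, 0) ∈ ⋃ i ∈ G, 𝓔 i := by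
    intro r m
    induction m with
    | zero => rfl
    | succ m ih => exact (hstep r m).symm.trans ih
  refine ⟨fun r => ?_, ?_⟩
  · by_cases h : (r, 0) ∈ ⋃ i ∈ G, 𝓔 i
    · exact Or.inl fun m => (hzero r m).2 h
    · exact Or.inr fun m hm => h ((hzero r m).1 hm)
  · rintro ⟨r, m, m', hm, hm'⟩
    exact hm' ((hzero r m').2 ((hzero r m).1 hm))
end

section
/- Let R be a system with temporal imprecision, let e be any event, and let G be a set of agents with at least two elements. Then for every run r ∈ R and every time m, (r,m) ∈ C_G e if and only if (r,0) ∈ C_G e; that is, no fact can become common knowledge during a run of a system with temporal imprecision. -/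
open Set

/-- Common knowledge among `G` is preserved under indistinguishability for a member of `G`. -/
theorem mem_Cn_of_eq {A Se : Type*} {S : A → Type*} {R : Type*}
    {st : R → ℕ → Se × (∀ i, S i)} {G : Set A} {e : Set (R × ℕ)} {i : A} (hi : i ∈ G)
    {p q : R × ℕ} (h : (st q.1 q.2).2 i = (st p.1 p.2).2 i) (hp : p ∈ Cn st G e) :
    q ∈ Cn st G e := by
  simp only [Cn, mem_iInter] at hp ⊢
  intro k _
  have hk := hp (k + 1) (Nat.le_add_left 1 k)
  rw [Function.iterate_succ_apply'] at hk
  exact mem_iInter₂.1 hk i hi q h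

/-- Corollary 4: in a system with temporal imprecision, for every event
`e`, every set `G` of at least two agents, every run `r`, and every time `m`, `C_G e` holds
at `(r,m)` iff it holds at `(r,0)`: no fact can become common knowledge during a run. -/
theorem no_common_knowledge_gain_with_temporal_imprecision
    {A Se : Type*} {S : A → Type*} {R : Type*}
    (st : R → ℕ → Se × (∀ i, S i))
    (hti : TemporalImprecision st)
    (e : Set (R × ℕ)) (G : Set A) (hG : G.Nontrivial)
    (r : R) (m : ℕ) :
    (r, m) ∈ Cn st G e ↔ (r, 0) ∈ Cn st G e := by
  induction m with
  | zero => rfl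
  | succ m ih =>
    rw [← ih]
    obtain ⟨i, hi, j, hj, -, r', m', h₁, h₂⟩ := hti r m G hG
    exact ⟨fun h ↦ mem_Cn_of_eq hi (p := (r', m')) h₁.symm (mem_Cn_of_eq hj h₂ h),
      fun h ↦ mem_Cn_of_eq hj (p := (r', m')) h₂.symm (mem_Cn_of_eq hi h₁ h)⟩
end

section
/- If 𝓔 is an ε-coordinated ensemble for a set G of agents (ε ∈ ℕ), then ψ_𝓔 ⊆ C^ε_G ψ_𝓔, where ψ_𝓔 = ⋃_{i∈G} 𝓔(i); that is, at every point where some event of the ensemble holds, ψ_𝓔 is ε-common knowledge among G. -/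
open Set

/-- `E^ε_G e`: there is an interval `[m', m'+ε]` containing the current time such that
every agent in `G` knows `e` at some point of the interval. -/
def Eeps {A Se : Type*} {S : A → Type*} {R : Type*}
    (st : R → ℕ → Se × (∀ i, S i)) (ε : ℕ) (G : Set A) (e : Set (R × ℕ)) :
    Set (R × ℕ) :=
  {p | ∃ m' : ℕ, m' ≤ p.2 ∧ p.2 ≤ m' + ε ∧
    ∀ i ∈ G, ∃ mi : ℕ, m' ≤ mi ∧ mi ≤ m' + ε ∧ (p.1, mi) ∈ Kn st i e}

/-- `ε`-common knowledge `C^ε_G e`: the greatest fixed point `ν x [E^ε_G (e ∩ x)]`. -/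
def Ceps {A Se : Type*} {S : A → Type*} {R : Type*}
    (st : R → ℕ → Se × (∀ i, S i)) (ε : ℕ) (G : Set A) (e : Set (R × ℕ)) :
    Set (R × ℕ) :=
  ⋃₀ {x : Set (R × ℕ) | x ⊆ Eeps st ε G (e ∩ x)}

/-- An ensemble `𝓔` for `G` is `ε`-coordinated if whenever some `𝓔(i)` holds, all the
events `𝓔(j)`, `j ∈ G`, hold within a single interval of `ε` time units containing the
current time. -/
def EpsCoordinated {A Se : Type*} {S : A → Type*} {R : Type*}
    (st : R → ℕ → Se × (∀ i, S i)) (ε : ℕ) (G : Set A) (𝓔 : A → Set (R × ℕ)) : Prop :=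
  ∀ (r : R) (m : ℕ), ∀ i ∈ G, (r, m) ∈ 𝓔 i →
    ∃ m' : ℕ, m' ≤ m ∧ m ≤ m' + ε ∧
      ∀ j ∈ G, ∃ mj : ℕ, m' ≤ mj ∧ mj ≤ m' + ε ∧ (r, mj) ∈ 𝓔 j

/-- Proposition 5(b): if `𝓔` is an `ε`-coordinated ensemble for `G`,
then `ψ_𝓔 ⊆ C^ε_G ψ_𝓔`, where `ψ_𝓔 = ⋃_{i∈G} 𝓔(i)`. -/
theorem eps_coordinated_ensemble_eps_common_knowledge
    {A Se : Type*} {S : A → Type*} {R : Type*}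
    (st : R → ℕ → Se × (∀ i, S i)) (ε : ℕ) (G : Set A) (𝓔 : A → Set (R × ℕ))
    (hloc : ∀ i ∈ G, IsLocal st i (𝓔 i))
    (hec : EpsCoordinated st ε G 𝓔) :
    (⋃ i ∈ G, 𝓔 i) ⊆ Ceps st ε G (⋃ i ∈ G, 𝓔 i) := by
  refine subset_sUnion_of_mem fun ⟨r, m⟩ hp => ?_
  obtain ⟨i, hi, hmem⟩ := mem_iUnion₂.1 hp
  obtain ⟨m', hle, hge, h⟩ := hec r m i hi hmem
  refine ⟨m', hle, hge, fun j hj => ?_⟩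
  obtain ⟨mj, hl, hu, hmj⟩ := h j hj
  refine ⟨mj, hl, hu, fun q hq => ?_⟩
  have hqj : q ∈ ⋃ i ∈ G, 𝓔 i := mem_biUnion hj ((hloc j hj q (r, mj) hq).2 hmj)
  exact ⟨hqj, hqj⟩
end

section
/- For every event e and every set G of agents, the assignment 𝓔(i) = K_i(C^◇_G e) for i ∈ G is an ensemble for G (i.e., each event K_i(C^◇_G e) is local to agent i) and this ensemble is eventually coordinated. -/
open Set

/-- `E^◇_G e`: every agent in `G` knows `e` at some time in the current run. -/
def Ediam {A Se : Type*} {S : A → Type*} {R : Type*}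
    (st : R → ℕ → Se × (∀ i, S i)) (G : Set A) (e : Set (R × ℕ)) : Set (R × ℕ) :=
  {p | ∀ i ∈ G, ∃ mi : ℕ, (p.1, mi) ∈ Kn st i e}

/-- Eventual common knowledge `C^◇_G e`: the greatest fixed point `ν x [E^◇_G (e ∩ x)]`. -/
def Cdiam {A Se : Type*} {S : A → Type*} {R : Type*}
    (st : R → ℕ → Se × (∀ i, S i)) (G : Set A) (e : Set (R × ℕ)) : Set (R × ℕ) :=
  ⋃₀ {x : Set (R × ℕ) | x ⊆ Ediam st G (e ∩ x)}

/-- An ensemble `𝓔` for `G` is eventually coordinated if whenever some `𝓔(i)` holds in a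
run, each `𝓔(j)`, `j ∈ G`, holds at some time in that run. -/
def EventuallyCoordinated {A Se : Type*} {S : A → Type*} {R : Type*}
    (st : R → ℕ → Se × (∀ i, S i)) (G : Set A) (𝓔 : A → Set (R × ℕ)) : Prop :=
  ∀ (r : R) (m : ℕ), ∀ i ∈ G, (r, m) ∈ 𝓔 i → ∀ j ∈ G, ∃ mj : ℕ, (r, mj) ∈ 𝓔 j

/-- for every event `e` and set `G` of agents, the assignment
`𝓔(i) = K_i (C^◇_G e)` is an ensemble for `G` (each event is local to `i`) and this
ensemble is eventually coordinated. -/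
theorem ensemble_KiCdiam_eventually_coordinated
    {A Se : Type*} {S : A → Type*} {R : Type*}
    (st : R → ℕ → Se × (∀ i, S i)) (e : Set (R × ℕ)) (G : Set A) :
    (∀ i ∈ G, IsLocal st i (Kn st i (Cdiam st G e))) ∧
    EventuallyCoordinated st G (fun i => Kn st i (Cdiam st G e)) := by
  refine ⟨fun i _ p q hpq => ?_, fun r m i _ hi j hj => ?_⟩
  · simp only [Kn, mem_ofPred_eq, hpq]
  · obtain ⟨x, hx, hmem⟩ := hi (r, m) rfl
    obtain ⟨mj, hmj⟩ := hx hmem j hj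
    exact ⟨mj, fun q hq => mem_sUnion_of_mem (hmj q hq).2 hx⟩
end

section
/- If 𝓔 is an eventually coordinated ensemble for a set G of agents, then ψ_𝓔 ⊆ C^◇_G ψ_𝓔, where ψ_𝓔 = ⋃_{i∈G} 𝓔(i); that is, at every point where some event of the ensemble holds, ψ_𝓔 is eventual common knowledge among G. -/
open Set

/-- if `𝓔` is an eventually coordinated ensemble for `G`, then
`ψ_𝓔 ⊆ C^◇_G ψ_𝓔`, where `ψ_𝓔 = ⋃_{i∈G} 𝓔(i)`. -/
theorem eventually_coordinated_ensemble_eventual_common_knowledge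
    {A Se : Type*} {S : A → Type*} {R : Type*}
    (st : R → ℕ → Se × (∀ i, S i)) (G : Set A) (𝓔 : A → Set (R × ℕ))
    (hloc : ∀ i ∈ G, IsLocal st i (𝓔 i))
    (hec : EventuallyCoordinated st G 𝓔) :
    (⋃ i ∈ G, 𝓔 i) ⊆ Cdiam st G (⋃ i ∈ G, 𝓔 i) := by
  intro p hp
  refine mem_sUnion.2 ⟨⋃ i ∈ G, 𝓔 i, ?_, hp⟩
  rintro ⟨r, m⟩ hrm j hj
  obtain ⟨i, hi, hri⟩ := mem_iUnion₂.1 hrm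
  obtain ⟨mj, hmj⟩ := hec r m i hi hri j hj
  refine ⟨mj, fun q hq => ?_⟩
  rw [inter_self]
  exact mem_iUnion₂.2 ⟨j, hj, (hloc j hj q (r, mj) hq).2 hmj⟩
end

section
/- (Muddy children) Let n ∈ ℕ and let w : Fin n → Bool be a world in which exactly k children are muddy, with k ≥ 1 (i.e., the set {j : w j = true} has cardinality k). Then w ∈ E^{k−1} p and w ∉ E^k p, where E^0 p = p: before the father speaks, everyone-knows iterated k−1 times of the fact that at least one child is muddy holds, but everyone-knows iterated k times does not. -/
open Set

/-- Muddy children: child `i` knows event `e` at world `w` iff `e` holds at every world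
agreeing with `w` on all foreheads other than `i`'s. -/
def Km (n : ℕ) (i : Fin n) (e : Set (Fin n → Bool)) : Set (Fin n → Bool) :=
  {w | ∀ w' : Fin n → Bool, (∀ j : Fin n, j ≠ i → w' j = w j) → w' ∈ e}

/-- Everyone (all `n` children) knows `e`. -/
def Em (n : ℕ) (e : Set (Fin n → Bool)) : Set (Fin n → Bool) :=
  ⋂ i : Fin n, Km n i e

/-- The event that at least one child has a muddy forehead. -/
def pMuddy (n : ℕ) : Set (Fin n → Bool) :=
  {w | ∃ j : Fin n, w j = true}

/-- The number of muddy children in the world `w`. -/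
def muddyCount {n : ℕ} (w : Fin n → Bool) : ℕ :=
  (Finset.univ.filter fun j : Fin n => w j = true).card

theorem mem_Em_iff {n : ℕ} {e : Set (Fin n → Bool)} {w : Fin n → Bool} :
    w ∈ Em n e ↔ ∀ (i : Fin n) (w' : Fin n → Bool), (∀ j, j ≠ i → w' j = w j) → w' ∈ e := by
  simp [Em, Km]

theorem mem_pMuddy_iff {n : ℕ} {w : Fin n → Bool} : w ∈ pMuddy n ↔ 0 < muddyCount w := by
  simp [pMuddy, muddyCount, Finset.card_pos, Finset.filter_nonempty_iff]

theorem muddyCount_le_succ_of_agree {n : ℕ} {i : Fin n} {w w' : Fin n → Bool}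
    (h : ∀ j, j ≠ i → w' j = w j) : muddyCount w ≤ muddyCount w' + 1 := by
  refine (Finset.card_le_card fun j hj => ?_).trans (Finset.card_insert_le i _)
  by_cases hji : j = i
  · simp [hji]
  · simpa [hji, h j hji] using hj

theorem muddyCount_update_false {n : ℕ} {i : Fin n} {w : Fin n → Bool} (hi : w i = true) :
    muddyCount (Function.update w i false) + 1 = muddyCount w := by
  have hset : (Finset.univ.filter fun j => Function.update w i false j = true) =
      (Finset.univ.filter fun j => w j = true).erase i := by
    ext j
    by_cases hji : j = i <;> simp [hji]
  rw [muddyCount, muddyCount, hset]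
  exact Finset.card_erase_add_one (by simpa using hi)

theorem mem_iterate_Em_pMuddy_iff {n : ℕ} [Nonempty (Fin n)] {m : ℕ} {w : Fin n → Bool} :
    w ∈ (Em n)^[m] (pMuddy n) ↔ m < muddyCount w := by
  induction m generalizing w with
  | zero => exact mem_pMuddy_iff
  | succ m ih =>
    rw [Function.iterate_succ_apply', mem_Em_iff]
    simp only [ih]
    refine ⟨fun h => ?_, fun h i w' hw' => ?_⟩
    · have hpos : 0 < muddyCount w :=
        (Nat.zero_le m).trans_lt (h (Classical.arbitrary _) w fun _ _ => rfl)
      obtain ⟨i, hi⟩ := mem_pMuddy_iff.2 hpos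
      have hlt := h i (Function.update w i false) fun j hj => Function.update_of_ne hj _ _
      have hcount := muddyCount_update_false hi
      omega
    · have hcount := muddyCount_le_succ_of_agree hw'
      omega

/-- muddy children: if exactly `k ≥ 1` children are muddy in world `w`,
then `E^{k-1} p` holds at `w` but `E^k p` does not, where `p` is the event that at least
one child is muddy and `E^0 p = p`. -/
theorem muddy_children_Ek
    (n k : ℕ) (hk : 1 ≤ k) (w : Fin n → Bool)
    (hcard : (Finset.univ.filter fun j : Fin n => w j = true).card = k) :
    w ∈ (Em n)^[k - 1] (pMuddy n) ∧ w ∉ (Em n)^[k] (pMuddy n) := by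
  have hcount : muddyCount w = k := hcard
  obtain ⟨i, -⟩ := mem_pMuddy_iff.2 (hcount ▸ hk : 0 < muddyCount w)
  have : Nonempty (Fin n) := ⟨i⟩
  rw [mem_iterate_Em_pMuddy_iff, mem_iterate_Em_pMuddy_iff]
  omega
end

section
/- (Muddy children, no common knowledge before the announcement) Let n ∈ ℕ. In the muddy children Kripke model, common knowledge of p holds at no world: for every w ∈ W there exists k with w ∉ E^k p, i.e., ⋂_{k≥0} E^k p = ∅. -/
open Set

/-- When exactly `m` children are muddy, `E^m p` fails. -/
theorem not_mem_iterate_Em_of_card_eq (n m : ℕ) (w : Fin n → Bool)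
    (hw : (Finset.univ.filter fun j => w j = true).card = m) :
    w ∉ (Em n)^[m] (pMuddy n) := by
  induction m generalizing w with
  | zero =>
    rintro ⟨j, hj⟩
    rw [Finset.card_eq_zero] at hw
    have hmem : j ∈ Finset.univ.filter fun j => w j = true := by simpa using hj
    simp [hw] at hmem
  | succ m ih =>
    intro h
    obtain ⟨j, hj⟩ := Finset.card_pos.mp (by lia : 0 < (Finset.univ.filter fun j => w j = true).card)
    rw [Function.iterate_succ_apply'] at h
    refine ih (Function.update w j false) ?_
      (mem_iInter.mp h j _ fun i hi => Function.update_of_ne hi _ _)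
    have herase : (Finset.univ.filter fun i => Function.update w j false i = true) =
        (Finset.univ.filter fun i => w i = true).erase j := by
      ext i
      by_cases hi : i = j
      · subst hi
        simp
      · simp [hi]
    rw [herase, Finset.card_erase_of_mem hj, hw, Nat.add_sub_cancel]

/-- muddy children, no common knowledge before the announcement:
at every world some iterate `E^k p` fails, i.e., `⋂_{k≥0} E^k p = ∅`. -/
theorem muddy_children_no_common_knowledge (n : ℕ) :
    (∀ w : Fin n → Bool, ∃ k : ℕ, w ∉ (Em n)^[k] (pMuddy n)) ∧
    (⋂ k : ℕ, (Em n)^[k] (pMuddy n)) = ∅ := by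
  have hfail (w : Fin n → Bool) : ∃ k : ℕ, w ∉ (Em n)^[k] (pMuddy n) :=
    ⟨_, not_mem_iterate_Em_of_card_eq n _ w rfl⟩
  refine ⟨hfail, eq_empty_of_forall_notMem fun w hw => ?_⟩
  obtain ⟨k, hk⟩ := hfail w
  exact hk (mem_iInter.mp hw k)
end

section
/- For every event e and every finite set G of agents, E^◇_G e = ⋃_{ε ∈ ℕ} E^ε_G e; that is, the eventual everyone-knows operator is the limit of the ε-interval everyone-knows operators as ε approaches infinity. -/
open Set

/-- for a finite set `G` of agents, the eventual everyone-knows operator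
is the limit of the `ε`-interval everyone-knows operators: `E^◇_G e = ⋃_{ε∈ℕ} E^ε_G e`. -/
theorem Ediam_eq_iUnion_Eeps
    {A Se : Type*} {S : A → Type*} {R : Type*}
    (st : R → ℕ → Se × (∀ i, S i)) (e : Set (R × ℕ)) (G : Set A)
    (hGfin : G.Finite) :
    Ediam st G e = ⋃ ε : ℕ, Eeps st ε G e := by
  ext ⟨r, m⟩
  simp only [mem_iUnion]
  constructor
  · intro h
    choose! t ht using h
    obtain ⟨b, hb⟩ := (hGfin.image t).bddAbove
    exact ⟨max m b, 0, m.zero_le, by simp, fun i hi =>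
      ⟨t i, (t i).zero_le, by simp [hb (mem_image_of_mem t hi)], ht i hi⟩⟩
  · rintro ⟨ε, m', -, -, h⟩ i hi
    obtain ⟨mi, -, -, hmi⟩ := h i hi
    exact ⟨mi, hmi⟩
end

section
/- For every event e, every ε ∈ ℕ, and every nonempty finite set G of agents, ε-common knowledge is definable as an infinite conjunction: C^ε_G e = ⋂_{k ∈ ℕ} f^k(⊤), where f is the map on events given by f(x) = E^ε_G(e ∩ x), f^k is its k-fold iterate, and ⊤ is the event consisting of all points. -/
open Set

/-- Pigeonhole for decreasing predicates: if each stage has a witness bounded by `N`, then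
some bounded witness works for all stages. -/
theorem Nat.exists_le_forall_of_antitone {P : ℕ → ℕ → Prop} {N : ℕ}
    (hP : ∀ n, Antitone fun k => P k n) (h : ∀ k, ∃ n ≤ N, P k n) :
    ∃ n ≤ N, ∀ k, P k n := by
  by_contra! hc
  choose! K hK using hc
  obtain ⟨n, hn, hPn⟩ := h ((Finset.range (N + 1)).sup K)
  exact hK n hn (hP n (Finset.le_sup (Finset.mem_range.2 (by omega))) hPn)

section

variable {A Se : Type*} {S : A → Type*} {R : Type*}
  (st : R → ℕ → Se × (∀ i, S i))

theorem Kn_mono (i : A) : Monotone (Kn st i) :=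
  fun _ _ h _ hp q hq => h (hp q hq)

theorem Kn_iInter {ι : Sort*} (i : A) (x : ι → Set (R × ℕ)) :
    Kn st i (⋂ k, x k) = ⋂ k, Kn st i (x k) := by
  ext p
  simp only [Kn, mem_iInter, mem_ofPred_eq]
  exact ⟨fun h k q hq => h q hq k, fun h q hq k => h k q hq⟩

theorem Eeps_mono (ε : ℕ) (G : Set A) : Monotone (Eeps st ε G) := by
  rintro x y h p ⟨m', h1, h2, h3⟩
  refine ⟨m', h1, h2, fun i hi => ?_⟩
  obtain ⟨mi, h4, h5, h6⟩ := h3 i hi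
  exact ⟨mi, h4, h5, Kn_mono st i h h6⟩

/-- `Eeps` is continuous along decreasing sequences of events. -/
theorem iInter_Eeps_subset (ε : ℕ) (G : Set A) {x : ℕ → Set (R × ℕ)} (hx : Antitone x) :
    ⋂ k, Eeps st ε G (x k) ⊆ Eeps st ε G (⋂ k, x k) := by
  intro p hp
  rw [mem_iInter] at hp
  obtain ⟨m', hm', h⟩ := Nat.exists_le_forall_of_antitone (N := p.2)
    (P := fun k m' => p.2 ≤ m' + ε ∧
      ∀ i ∈ G, ∃ mi : ℕ, m' ≤ mi ∧ mi ≤ m' + ε ∧ (p.1, mi) ∈ Kn st i (x k))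
    (fun m' k l hkl ⟨h2, h3⟩ => ⟨h2, fun i hi =>
      let ⟨mi, h4, h5, h6⟩ := h3 i hi
      ⟨mi, h4, h5, Kn_mono st i (hx hkl) h6⟩⟩) hp
  refine ⟨m', hm', (h 0).1, fun i hi => ?_⟩
  obtain ⟨mi, hmi, h'⟩ := Nat.exists_le_forall_of_antitone (N := m' + ε)
    (P := fun k mi => m' ≤ mi ∧ (p.1, mi) ∈ Kn st i (x k))
    (fun mi k l hkl ⟨h4, h6⟩ => ⟨h4, Kn_mono st i (hx hkl) h6⟩)
    (fun k => let ⟨mi, h4, h5, h6⟩ := (h k).2 i hi; ⟨mi, h5, h4, h6⟩)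
  refine ⟨mi, (h' 0).1, hmi, ?_⟩
  rw [Kn_iInter, mem_iInter]
  exact fun k => (h' k).2

end

/-- for every event `e`, `ε ∈ ℕ`, and nonempty finite set `G` of agents,
`ε`-common knowledge is definable as an infinite conjunction: `C^ε_G e = ⋂_k f^k(⊤)`
where `f x = E^ε_G (e ∩ x)` and `⊤` is the event of all points. -/
theorem Ceps_eq_iInter_iterate
    {A Se : Type*} {S : A → Type*} {R : Type*}
    (st : R → ℕ → Se × (∀ i, S i)) (e : Set (R × ℕ)) (ε : ℕ) (G : Set A)
    (hne : G.Nonempty) (hGfin : G.Finite) :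
    Ceps st ε G e =
      ⋂ k : ℕ, (fun x : Set (R × ℕ) => Eeps st ε G (e ∩ x))^[k] Set.univ := by
  set f : Set (R × ℕ) → Set (R × ℕ) := fun x => Eeps st ε G (e ∩ x)
  have hmono : Monotone f := fun x y h => Eeps_mono st ε G (inter_subset_inter_right e h)
  apply Subset.antisymm
  · refine sUnion_subset fun x (hx : x ⊆ f x) => subset_iInter fun k => ?_
    induction k with
    | zero => exact subset_univ x
    | succ k ih =>
      rw [Function.iterate_succ_apply']
      exact hx.trans (hmono ih)
  · have hanti : Antitone fun k => f^[k] univ :=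
      hmono.antitone_iterate_of_map_le (subset_univ _)
    refine subset_sUnion_of_mem ?_
    change _ ⊆ Eeps st ε G (e ∩ ⋂ k, f^[k] univ)
    rw [inter_iInter]
    refine Subset.trans ?_ (iInter_Eeps_subset st ε G
      fun k l hkl => inter_subset_inter_right e (hanti hkl))
    refine subset_iInter fun k => (iInter_subset _ (k + 1)).trans ?_
    rw [Function.iterate_succ_apply']
end
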